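/- For n ≥ 2 let S_n denote the set of monic irreducible polynomials P ∈ 𝔽₂[T] with deg P ≤ n. Then there exists a constant c such that ∑_{P ∈ S_n, coeff₀(P) = 1, coeff₁(P) = 1} 2^{−(deg P)/2} − ∑_{P ∈ S_n, coeff₀(P) = 1, coeff₁(P) = 0} 2^{−(deg P)/2} = (1/2) · log n + c + o(1) as n → ∞, where coeff₀(P) and coeff₁(P) denote the constant coefficient and the coefficient of T in P. (This statement is unconditional.) -/

import Mathlib

open Filter Finset

section MonicIrreducible

open Polynomial UniqueFactorizationMonoid
open scoped Classical

section MonicPolynomials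

variable {F : Type*} [Field F] [Fintype F]

variable (F) in
/-- The monic polynomials of degree `n` over a finite field. -/
noncomputable def monicOfDegree : ℕ → Finset F[X]
  | 0 => {1}
  | n + 1 => (monicOfDegree n ×ˢ univ).image fun p => p.1 * X + C p.2

theorem mem_monicOfDegree {n : ℕ} {f : F[X]} :
    f ∈ monicOfDegree F n ↔ f.Monic ∧ f.natDegree = n := by
  induction n generalizing f with
  | zero =>
    simp only [monicOfDegree, mem_singleton]
    constructor
    · rintro rfl; simp
    · rintro ⟨h, h'⟩; exact h.natDegree_eq_zero.mp h'
  | succ n ih =>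
    simp only [monicOfDegree, mem_image, mem_product, mem_univ, and_true, Prod.exists, ih]
    constructor
    · rintro ⟨g, c, ⟨hg, rfl⟩, rfl⟩
      have hd : (C c).degree < (g * X).degree := by
        refine degree_C_le.trans_lt ?_
        rw [degree_mul, degree_X, degree_eq_natDegree hg.ne_zero]
        exact_mod_cast Nat.succ_pos _
      refine ⟨(hg.mul monic_X).add_of_left hd, ?_⟩
      rw [natDegree_add_eq_left_of_degree_lt hd, hg.natDegree_mul monic_X, natDegree_X]
    · rintro ⟨hf, hn⟩
      refine ⟨f.divX, f.coeff 0, ⟨?_, ?_⟩, f.divX_mul_X_add⟩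
      · rw [Monic, leadingCoeff, natDegree_divX_eq_natDegree_tsub_one, coeff_divX, hn]
        simpa [Monic, leadingCoeff, hn] using hf
      · rw [natDegree_divX_eq_natDegree_tsub_one, hn, Nat.add_sub_cancel]

theorem sum_monicOfDegree_succ {R : Type*} [AddCommMonoid R] (φ : F[X] → R) (n : ℕ) :
    ∑ f ∈ monicOfDegree F (n + 1), φ f = ∑ f ∈ monicOfDegree F n, ∑ c, φ (f * X + C c) := by
  rw [monicOfDegree, sum_image, sum_product]
  rintro ⟨f, c⟩ - ⟨g, d⟩ - h
  have h0 : c = d := by simpa using congrArg (fun p => coeff p 0) h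
  subst h0
  simpa using h

theorem card_monicOfDegree (n : ℕ) : #(monicOfDegree F n) = Fintype.card F ^ n := by
  induction n with
  | zero => simp [monicOfDegree]
  | succ n ih =>
    rw [card_eq_sum_ones, sum_monicOfDegree_succ]
    simp [ih, pow_succ]

variable (F) in
/-- The monic irreducible polynomials of degree `d` over a finite field. -/
noncomputable def monicIrreducibleOfDegree (d : ℕ) : Finset F[X] :=
  {P ∈ monicOfDegree F d | Irreducible P}

theorem mem_monicIrreducibleOfDegree {d : ℕ} {P : F[X]} :
    P ∈ monicIrreducibleOfDegree F d ↔ P.Monic ∧ P.natDegree = d ∧ Irreducible P := by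
  simp [monicIrreducibleOfDegree, mem_monicOfDegree, and_assoc]

theorem natDegree_eq_sum_prime_powers {n : ℕ} {f : F[X]} (hf : f ∈ monicOfDegree F n) :
    n = ∑ d ∈ Icc 1 n, ∑ P ∈ monicIrreducibleOfDegree F d, ∑ k ∈ Icc 1 n,
      if P ^ k ∣ f then d else 0 := by
  obtain ⟨hm, hn⟩ := mem_monicOfDegree.mp hf
  have hf0 := hm.ne_zero
  have hcount : ∀ d ∈ Icc 1 n, ∀ P ∈ monicIrreducibleOfDegree F d,
      (∑ k ∈ Icc 1 n, if P ^ k ∣ f then d else 0) =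
        (normalizedFactors f).count P * P.natDegree := by
    intro d hd P hP
    obtain ⟨hPm, hPd, hPi⟩ := mem_monicIrreducibleOfDegree.mp hP
    have hdvd : ∀ k, P ^ k ∣ f ↔ k ≤ (normalizedFactors f).count P := by
      intro k
      rw [pow_dvd_iff_le_emultiplicity, emultiplicity_eq_count_normalizedFactors hPi hf0,
        hPm.normalize_eq_self]
      exact_mod_cast Iff.rfl
    have hle : (normalizedFactors f).count P ≤ n := by
      have := natDegree_le_of_dvd ((hdvd _).mpr le_rfl) hf0
      rw [natDegree_pow, hn, hPd] at this
      exact (Nat.le_mul_of_pos_right _ (mem_Icc.mp hd).1).trans this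
    rw [← sum_filter, sum_const, smul_eq_mul, hPd]
    congr 1
    rw [show {k ∈ Icc 1 n | P ^ k ∣ f} = Icc 1 ((normalizedFactors f).count P) by
      ext k
      simp only [mem_filter, mem_Icc, hdvd]
      omega]
    simp
  rw [sum_congr rfl fun d hd => sum_congr rfl (hcount d hd), sum_sigma']
  have hdeg : f.natDegree = ((normalizedFactors f).map natDegree).sum := by
    conv_lhs => rw [← hm.normalize_eq_self, ← prod_normalizedFactors_eq hf0]
    exact natDegree_multiset_prod _ (zero_notMem_normalizedFactors f)
  refine (hn.symm.trans (hdeg.trans (sum_multiset_map_count _ _))).trans ?_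
  simp only [smul_eq_mul]
  symm
  refine sum_bij_ne_zero (fun x _ _ => x.2) ?_ ?_ ?_ ?_
  · intro x _ hx
    rw [Multiset.mem_toFinset, ← Multiset.one_le_count_iff_mem]
    exact Nat.one_le_iff_ne_zero.mpr (left_ne_zero_of_mul hx)
  · rintro ⟨d, P⟩ hx - ⟨e, Q⟩ hy - (rfl : P = Q)
    simp only [mem_sigma, mem_monicIrreducibleOfDegree] at hx hy
    rw [Sigma.mk.injEq]
    exact ⟨hx.2.2.1.symm.trans hy.2.2.1, HEq.rfl⟩
  · intro P hP hP0
    rw [Multiset.mem_toFinset] at hP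
    have hPi := irreducible_of_normalized_factor P hP
    refine ⟨⟨P.natDegree, P⟩, ?_, hP0, rfl⟩
    simp only [mem_sigma, mem_monicIrreducibleOfDegree, mem_Icc]
    refine ⟨⟨hPi.natDegree_pos, ?_⟩, ?_, trivial, hPi⟩
    · rw [← hn]
      exact natDegree_le_of_dvd (dvd_of_mem_normalizedFactors hP) hf0
    · rw [← normalize_normalized_factor P hP]
      exact monic_normalize hPi.ne_zero
  · intros; rfl

theorem sum_monicOfDegree_filter_dvd {R : Type*} [CommSemiring R] (ψ : F[X] →* R) (n : ℕ)
    {g : F[X]} (hg : g.Monic) :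
    (∑ f ∈ monicOfDegree F n with g ∣ f, ψ f) =
      if g.natDegree ≤ n then ψ g * ∑ f ∈ monicOfDegree F (n - g.natDegree), ψ f else 0 := by
  split_ifs with h
  · simp_rw [mul_sum, ← map_mul]
    symm
    refine sum_bij (fun f _ => g * f) ?_ ?_ ?_ ?_
    · intro f hf
      obtain ⟨hm, hd⟩ := mem_monicOfDegree.mp hf
      rw [mem_filter, mem_monicOfDegree, hg.natDegree_mul hm]
      exact ⟨⟨hg.mul hm, by omega⟩, dvd_mul_right _ _⟩
    · intro f _ f' _ hff
      exact mul_left_cancel₀ hg.ne_zero hff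
    · intro f hf
      obtain ⟨hf, f', rfl⟩ := mem_filter.mp hf
      obtain ⟨hm, hd⟩ := mem_monicOfDegree.mp hf
      have hm' := hg.of_mul_monic_left hm
      rw [hg.natDegree_mul hm'] at hd
      exact ⟨f', mem_monicOfDegree.mpr ⟨hm', by omega⟩, rfl⟩
    · intros; rfl
  · refine sum_eq_zero fun f hf => absurd ?_ h
    obtain ⟨hf, hgf⟩ := mem_filter.mp hf
    obtain ⟨hm, hd⟩ := mem_monicOfDegree.mp hf
    exact hd ▸ natDegree_le_of_dvd hgf hm.ne_zero

end MonicPolynomials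

theorem sum_Icc_Icc_eq_sum_divisors {R : Type*} [AddCommMonoid R] (φ : ℕ → ℕ → R) (n : ℕ) :
    (∑ d ∈ Icc 1 n, ∑ k ∈ Icc 1 n, if k * d ≤ n then φ d k else 0) =
      ∑ m ∈ Icc 1 n, ∑ d ∈ m.divisors, φ d (m / d) := by
  simp_rw [← sum_filter]
  rw [sum_sigma', sum_sigma']
  refine sum_bij' (fun x _ => ⟨x.2 * x.1, x.1⟩) (fun x _ => ⟨x.2, x.1 / x.2⟩) ?_ ?_ ?_ ?_ ?_
  · rintro ⟨d, k⟩ h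
    simp only [mem_sigma, mem_filter, mem_Icc, Nat.mem_divisors] at h ⊢
    obtain ⟨⟨hd, -⟩, ⟨hk, -⟩, h⟩ := h
    have := Nat.mul_pos hk hd
    exact ⟨⟨this, h⟩, dvd_mul_left _ _, this.ne'⟩
  · rintro ⟨m, d⟩ h
    simp only [mem_sigma, mem_filter, mem_Icc, Nat.mem_divisors] at h ⊢
    obtain ⟨⟨hm, hn⟩, hd, h0⟩ := h
    have hd0 := Nat.pos_of_dvd_of_pos hd hm
    refine ⟨⟨hd0, (Nat.le_of_dvd hm hd).trans hn⟩,
      ⟨Nat.div_pos (Nat.le_of_dvd hm hd) hd0, (Nat.div_le_self _ _).trans hn⟩, ?_⟩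
    rwa [Nat.div_mul_cancel hd]
  · rintro ⟨d, k⟩ h
    simp only [mem_sigma, mem_filter, mem_Icc] at h
    simp [Nat.mul_div_cancel k h.1.1]
  · rintro ⟨m, d⟩ h
    simp only [mem_sigma, mem_Icc, Nat.mem_divisors] at h
    simp [Nat.div_mul_cancel h.2.1]
  · rintro ⟨d, k⟩ h
    simp only [mem_sigma, mem_filter, mem_Icc] at h
    simp [Nat.mul_div_cancel k h.1.1]

section LFunction

variable {F R : Type*} [Field F] [Fintype F] [CommRing R] (ψ : F[X] →* R)

/-- The coefficient of `u ^ m` in the logarithmic derivative `u * d/du log L(u)`,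
where `L(u) = ∑ ψ f u ^ deg f`. -/
noncomputable def primePowerSum (m : ℕ) : R :=
  ∑ d ∈ m.divisors, (d : R) * ∑ P ∈ monicIrreducibleOfDegree F d, ψ P ^ (m / d)

theorem sum_primePowerSum_mul (n : ℕ) :
    ∑ m ∈ Icc 1 n, primePowerSum ψ m * ∑ f ∈ monicOfDegree F (n - m), ψ f =
      n * ∑ f ∈ monicOfDegree F n, ψ f := by
  have key : ∀ f ∈ monicOfDegree F n, (n : R) * ψ f = ∑ d ∈ Icc 1 n,
      ∑ P ∈ monicIrreducibleOfDegree F d, ∑ k ∈ Icc 1 n, if P ^ k ∣ f then d * ψ f else 0 := by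
    intro f hf
    conv_lhs => rw [natDegree_eq_sum_prime_powers hf]
    push_cast
    simp_rw [sum_mul, ite_mul, zero_mul]
  rw [mul_sum, sum_congr rfl key, sum_comm]
  have inner : ∀ d ∈ Icc 1 n, (∑ f ∈ monicOfDegree F n, ∑ P ∈ monicIrreducibleOfDegree F d,
      ∑ k ∈ Icc 1 n, if P ^ k ∣ f then d * ψ f else 0) =
      ∑ k ∈ Icc 1 n, if k * d ≤ n then
        d * (∑ P ∈ monicIrreducibleOfDegree F d, ψ P ^ k) *
          ∑ f ∈ monicOfDegree F (n - k * d), ψ f else 0 := by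
    intro d _
    rw [sum_comm, sum_congr rfl fun P _ => sum_comm, sum_comm]
    refine sum_congr rfl fun k _ => ?_
    have : ∀ P ∈ monicIrreducibleOfDegree F d,
        (∑ f ∈ monicOfDegree F n, if P ^ k ∣ f then d * ψ f else 0) =
        if k * d ≤ n then d * ψ P ^ k * ∑ f ∈ monicOfDegree F (n - k * d), ψ f else 0 := by
      intro P hP
      obtain ⟨hPm, hPd, -⟩ := mem_monicIrreducibleOfDegree.mp hP
      rw [← sum_filter, ← mul_sum, sum_monicOfDegree_filter_dvd ψ n (hPm.pow k), natDegree_pow,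
        hPd, map_pow]
      split_ifs <;> ring
    rw [sum_congr rfl this]
    split_ifs
    · rw [← sum_mul, ← mul_sum]
    · exact sum_const_zero
  rw [sum_congr rfl inner, sum_Icc_Icc_eq_sum_divisors (fun d k => (d : R) *
    (∑ P ∈ monicIrreducibleOfDegree F d, ψ P ^ k) * ∑ f ∈ monicOfDegree F (n - k * d), ψ f)]
  refine sum_congr rfl fun m _ => ?_
  rw [primePowerSum, sum_mul]
  refine sum_congr rfl fun d hd => ?_
  rw [Nat.div_mul_cancel (Nat.dvd_of_mem_divisors hd)]

theorem primePowerSum_one :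
    primePowerSum ψ 1 = ∑ f ∈ monicOfDegree F 1, ψ f := by
  have := sum_primePowerSum_mul ψ 1
  simpa [monicOfDegree] using this

theorem primePowerSum_add_two {r : R} (hr : ∀ m, ∑ f ∈ monicOfDegree F (m + 2), ψ f =
      r * ∑ f ∈ monicOfDegree F (m + 1), ψ f) (n : ℕ) :
    primePowerSum ψ (n + 2) = (r - ∑ f ∈ monicOfDegree F 1, ψ f) * primePowerSum ψ (n + 1) +
      ∑ f ∈ monicOfDegree F (n + 2), ψ f := by
  have h₁ := sum_primePowerSum_mul ψ (n + 1)
  have h₂ := sum_primePowerSum_mul ψ (n + 2)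
  have h₀ : ∑ f ∈ monicOfDegree F 0, ψ f = 1 := by simp [monicOfDegree]
  rw [sum_Icc_succ_top (by omega), Nat.sub_self, h₀] at h₁
  rw [sum_Icc_succ_top (by omega), sum_Icc_succ_top (by omega), Nat.sub_self, h₀,
    show n + 1 + 1 - (n + 1) = 1 by omega] at h₂
  have h₃ : ∑ m ∈ Icc 1 n, primePowerSum ψ m * ∑ f ∈ monicOfDegree F (n + 1 + 1 - m), ψ f =
      r * ∑ m ∈ Icc 1 n, primePowerSum ψ m * ∑ f ∈ monicOfDegree F (n + 1 - m), ψ f := by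
    rw [mul_sum]
    refine sum_congr rfl fun m hm => ?_
    have := (mem_Icc.mp hm).2
    rw [show n + 1 + 1 - m = n - m + 2 by omega, hr, show n + 1 - m = n - m + 1 by omega]
    ring
  rw [h₃] at h₂
  have h₄ := hr n
  push_cast at h₁ h₂
  linear_combination h₂ - r * h₁ + ((n : R) + 1) * h₄

end LFunction

section QuadraticCharacter

/-- The nontrivial character modulo `X ^ 2` over `𝔽₂`. -/
noncomputable def quadChar : (ZMod 2)[X] →* ℝ where
  toFun f := if f.coeff 0 = 0 then 0 else if f.coeff 1 = 0 then 1 else -1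
  map_one' := by simp [coeff_one]
  map_mul' f g := by
    rw [mul_coeff_zero, mul_coeff_one]
    generalize f.coeff 0 = a, f.coeff 1 = b, g.coeff 0 = c, g.coeff 1 = d
    have h : ∀ x : ZMod 2, x = 0 ∨ x = 1 := by decide
    rcases h a with rfl | rfl <;> rcases h b with rfl | rfl <;> rcases h c with rfl | rfl <;>
      rcases h d with rfl | rfl <;> simp [CharTwo.add_self_eq_zero]

theorem quadChar_apply (f : (ZMod 2)[X]) :
    quadChar f = if f.coeff 0 = 0 then 0 else if f.coeff 1 = 0 then 1 else -1 := rfl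

theorem quadChar_pow_odd (f : (ZMod 2)[X]) {k : ℕ} (hk : Odd k) :
    quadChar f ^ k = quadChar f := by
  rw [quadChar_apply]
  split_ifs
  · exact zero_pow hk.pos.ne'
  · exact one_pow k
  · exact hk.neg_one_pow

theorem quadChar_pow_even (f : (ZMod 2)[X]) {k : ℕ} (hk : Even k) (h0 : k ≠ 0) :
    quadChar f ^ k = quadChar f ^ 2 := by
  rw [quadChar_apply]
  split_ifs
  · rw [zero_pow h0, zero_pow two_ne_zero]
  · simp
  · rw [hk.neg_one_pow, even_two.neg_one_pow]

theorem abs_quadChar (f : (ZMod 2)[X]) : |quadChar f| = quadChar f ^ 2 := by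
  rw [quadChar_apply]
  split_ifs <;> simp

theorem sum_zmod_two {R : Type*} [AddCommMonoid R] (φ : ZMod 2 → R) :
    ∑ c, φ c = φ 0 + φ 1 := Fin.sum_univ_two φ

theorem quadChar_mul_X_add_C (f : (ZMod 2)[X]) (c : ZMod 2) :
    quadChar (f * X + C c) = if c = 0 then 0 else if f.coeff 0 = 0 then 1 else -1 := by
  simp [quadChar_apply, coeff_C]

theorem sum_quadChar_one : ∑ f ∈ monicOfDegree (ZMod 2) 1, quadChar f = -1 := by
  rw [sum_monicOfDegree_succ]
  simp only [quadChar_mul_X_add_C]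
  simp [monicOfDegree, sum_zmod_two]

theorem sum_quadChar_add_two (n : ℕ) :
    ∑ f ∈ monicOfDegree (ZMod 2) (n + 2), quadChar f = 0 := by
  rw [sum_monicOfDegree_succ]
  simp only [quadChar_mul_X_add_C]
  rw [sum_monicOfDegree_succ]
  simp [sum_zmod_two]

theorem sum_quadChar_sq_succ (n : ℕ) :
    ∑ f ∈ monicOfDegree (ZMod 2) (n + 1), (quadChar ^ 2) f = 2 ^ n := by
  rw [sum_monicOfDegree_succ]
  simp only [MonoidHom.pow_apply, quadChar_mul_X_add_C]
  have : ∀ f : (ZMod 2)[X],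
      ∑ c : ZMod 2, (if c = 0 then 0 else if f.coeff 0 = 0 then 1 else -1 : ℝ) ^ 2 = 1 := by
    intro f
    rw [sum_zmod_two]
    split_ifs <;> simp_all
  simp only [this, sum_const, card_monicOfDegree, ZMod.card]
  simp

theorem primePowerSum_quadChar (n : ℕ) : primePowerSum quadChar (n + 1) = -1 := by
  induction n with
  | zero => rw [primePowerSum_one, sum_quadChar_one]
  | succ n ih =>
    rw [primePowerSum_add_two quadChar (r := 0), ih, sum_quadChar_one, sum_quadChar_add_two]
    · norm_num
    · intro m
      rw [sum_quadChar_add_two, zero_mul]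

theorem primePowerSum_quadChar_sq (n : ℕ) :
    primePowerSum (quadChar ^ 2) (n + 1) = 2 ^ (n + 1) - 1 := by
  induction n with
  | zero => rw [primePowerSum_one, sum_quadChar_sq_succ]; norm_num
  | succ n ih =>
    rw [primePowerSum_add_two (quadChar ^ 2) (r := 2), ih, sum_quadChar_sq_succ,
      sum_quadChar_sq_succ]
    · ring
    · intro m
      rw [sum_quadChar_sq_succ, sum_quadChar_sq_succ, pow_succ']

theorem sum_divisors_quadChar {n : ℕ} (hn : 1 ≤ n) :
    ∑ d ∈ n.divisors, (d : ℝ) * (if Odd (n / d)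
      then ∑ P ∈ monicIrreducibleOfDegree (ZMod 2) d, quadChar P
      else ∑ P ∈ monicIrreducibleOfDegree (ZMod 2) d, quadChar P ^ 2) = -1 := by
  obtain ⟨n, rfl⟩ := Nat.exists_eq_add_of_le' hn
  rw [← primePowerSum_quadChar n]
  refine sum_congr rfl fun d hd => ?_
  congr 1
  split_ifs with h
  · exact sum_congr rfl fun P _ => (quadChar_pow_odd P h).symm
  · refine sum_congr rfl fun P _ => (quadChar_pow_even P (Nat.not_odd_iff_even.mp h) ?_).symm
    exact (Nat.div_pos (Nat.divisor_le hd) (Nat.pos_of_mem_divisors hd)).ne'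

theorem sum_divisors_quadChar_sq {n : ℕ} (hn : 1 ≤ n) :
    ∑ d ∈ n.divisors, (d : ℝ) * ∑ P ∈ monicIrreducibleOfDegree (ZMod 2) d, quadChar P ^ 2 =
      2 ^ n - 1 := by
  obtain ⟨n, rfl⟩ := Nat.exists_eq_add_of_le' hn
  rw [← primePowerSum_quadChar_sq n]
  refine sum_congr rfl fun d hd => ?_
  congr 1
  refine sum_congr rfl fun P _ => ?_
  have : (n + 1) / d ≠ 0 :=
    (Nat.div_pos (Nat.divisor_le hd) (Nat.pos_of_mem_divisors hd)).ne'
  rw [MonoidHom.pow_apply, ← pow_mul, quadChar_pow_even P (even_two_mul _) (by omega)]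

end QuadraticCharacter

section Asymptotics

variable {a b : ℕ → ℝ}

theorem sum_two_pow_le {m : ℕ} {s : Finset ℕ} (hs : s ⊆ Icc 1 m) :
    ∑ d ∈ s, (2 : ℝ) ^ d ≤ 2 ^ (m + 1) - 2 := by
  calc ∑ d ∈ s, (2 : ℝ) ^ d ≤ ∑ d ∈ Icc 1 m, (2 : ℝ) ^ d :=
        sum_le_sum_of_subset_of_nonneg hs fun _ _ _ => by positivity
    _ = 2 ^ (m + 1) - 2 := by
        clear hs
        induction m with
        | zero => norm_num
        | succ m ih => rw [sum_Icc_succ_top (by omega), ih]; ring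

theorem mul_le_two_pow (hb0 : ∀ n, 0 ≤ b n)
    (hb : ∀ n : ℕ, 1 ≤ n → ∑ d ∈ n.divisors, (d : ℝ) * b d = 2 ^ n - 1) {n : ℕ} (hn : 1 ≤ n) :
    n * b n ≤ 2 ^ n := by
  have h := single_le_sum (f := fun d : ℕ => (d : ℝ) * b d)
    (fun d _ => mul_nonneg d.cast_nonneg (hb0 d)) (Nat.mem_divisors_self n (by omega))
  rw [hb n hn] at h
  linarith

theorem abs_mul_sub_two_pow_le (hb0 : ∀ n, 0 ≤ b n)
    (hb : ∀ n : ℕ, 1 ≤ n → ∑ d ∈ n.divisors, (d : ℝ) * b d = 2 ^ n - 1) {n : ℕ} (hn : 1 ≤ n) :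
    |n * b n - 2 ^ n| ≤ 2 ^ (n / 2 + 1) := by
  have h := hb n hn
  rw [← add_sum_erase _ _ (Nat.mem_divisors_self n (by omega))] at h
  have hsub : n.divisors.erase n ⊆ Icc 1 (n / 2) := by
    intro d hd
    obtain ⟨hdn, hd⟩ := mem_erase.mp hd
    obtain ⟨k, rfl⟩ := Nat.dvd_of_mem_divisors hd
    have hd0 := Nat.pos_of_mem_divisors hd
    have hk : 2 ≤ k := by
      rcases k with _ | _ | k
      · omega
      · simp at hdn
      · omega
    exact mem_Icc.mpr ⟨hd0, (Nat.le_div_iff_mul_le two_pos).mpr (Nat.mul_le_mul_left d hk)⟩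
  have hle : ∑ d ∈ n.divisors.erase n, (d : ℝ) * b d ≤ 2 ^ (n / 2 + 1) - 2 :=
    (sum_le_sum fun d hd => mul_le_two_pow hb0 hb (mem_Icc.mp (hsub hd)).1).trans
      (sum_two_pow_le hsub)
  rw [abs_sub_comm, abs_of_nonneg (by linarith [mul_le_two_pow hb0 hb hn])]
  linarith

theorem abs_mul_add_le (hab : ∀ n, |a n| ≤ b n)
    (hb : ∀ n : ℕ, 1 ≤ n → ∑ d ∈ n.divisors, (d : ℝ) * b d = 2 ^ n - 1)
    (ha : ∀ n : ℕ, 1 ≤ n →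
      ∑ d ∈ n.divisors, (d : ℝ) * (if Odd (n / d) then a d else b d) = -1)
    {n : ℕ} (hn : 1 ≤ n) :
    |n * a n + if Even n then 2 ^ (n / 2) else 0| ≤ 2 ^ (n / 3 + 2) := by
  have hb0 : ∀ n, 0 ≤ b n := fun n => (abs_nonneg _).trans (hab n)
  set g : ℕ → ℝ := fun d => (d : ℝ) * (if Odd (n / d) then a d else b d) with hg
  have h : ∑ d ∈ n.divisors, g d = -1 := ha n hn
  set s := {d ∈ n.divisors | d ≠ n ∧ 2 * d ≠ n} with hs
  have hsub : s ⊆ Icc 1 (n / 3) := by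
    intro d hd
    obtain ⟨hd, hdn, hdn2⟩ := mem_filter.mp hd
    obtain ⟨k, rfl⟩ := Nat.dvd_of_mem_divisors hd
    have hd0 := Nat.pos_of_mem_divisors hd
    have hk : 3 ≤ k := by
      rcases k with _ | _ | _ | k
      · omega
      · simp at hdn
      · omega
      · omega
    exact mem_Icc.mpr ⟨hd0, (Nat.le_div_iff_mul_le three_pos).mpr (Nat.mul_le_mul_left d hk)⟩
  have hrest : |∑ d ∈ s, g d| ≤ 2 ^ (n / 3 + 1) - 2 := by
    refine (abs_sum_le_sum_abs _ _).trans ((sum_le_sum fun d hd => ?_).trans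
      (sum_two_pow_le hsub))
    refine le_trans ?_ (mul_le_two_pow hb0 hb (mem_Icc.mp (hsub hd)).1)
    rw [hg, abs_mul, Nat.abs_cast]
    refine mul_le_mul_of_nonneg_left ?_ d.cast_nonneg
    split_ifs
    · exact hab d
    · exact (abs_of_nonneg (hb0 d)).le
  have hgn : g n = n * a n := by simp [hg, Nat.div_self hn]
  have hpow : (2 : ℝ) ^ (n / 3 + 2) = 2 * 2 ^ (n / 3 + 1) := pow_succ' _ _
  rcases Nat.even_or_odd n with he | ho
  · obtain ⟨m, rfl⟩ := even_iff_exists_two_mul.mp he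
    have hm : 1 ≤ m := by omega
    have hdiv : (2 * m).divisors = insert (2 * m) (insert m s) := by
      ext d
      simp only [mem_insert, hs, mem_filter, Nat.mem_divisors]
      constructor
      · intro hd
        by_cases d = 2 * m <;> by_cases d = m <;> simp_all
      · rintro (rfl | rfl | h)
        · exact ⟨dvd_rfl, by omega⟩
        · exact ⟨dvd_mul_left _ _, by omega⟩
        · exact h.1
    have hgm : g m = m * b m := by simp [hg, Nat.mul_div_cancel _ hm]
    rw [hdiv, sum_insert (by simp [hs]; omega), sum_insert (by simp [hs]), hgn, hgm] at h
    have h2 := abs_mul_sub_two_pow_le hb0 hb hm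
    have h3 : (2 : ℝ) ^ (m / 2 + 1) ≤ 2 ^ (2 * m / 3 + 1) :=
      pow_le_pow_right₀ one_le_two (by omega)
    rw [if_pos he, Nat.mul_div_cancel_left _ two_pos]
    rw [abs_le] at hrest h2 ⊢
    constructor <;> linarith
  · have hdiv : n.divisors = insert n s := by
      ext d
      simp only [mem_insert, hs, mem_filter, Nat.mem_divisors]
      constructor
      · intro hd
        by_cases h1 : d = n
        · exact Or.inl h1
        · refine Or.inr ⟨hd, h1, fun h2 => ?_⟩
          exact Nat.not_even_iff_odd.mpr ho (h2 ▸ even_two_mul d)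
      · rintro (rfl | h)
        · exact ⟨dvd_rfl, by omega⟩
        · exact h.1
    rw [hdiv, sum_insert (by simp [hs]), hgn] at h
    have : (0 : ℝ) < 2 ^ (n / 3 + 1) := by positivity
    rw [if_neg (Nat.not_even_iff_odd.mpr ho)]
    rw [abs_le] at hrest ⊢
    constructor <;> linarith

theorem sum_even_inv_eq (N : ℕ) :
    ∑ d ∈ Icc 1 N, (if Even d then 1 / (d : ℝ) else 0) = 1 / 2 * (harmonic (N / 2) : ℝ) := by
  induction N with
  | zero => simp
  | succ N ih =>
    rw [sum_Icc_succ_top (by omega), ih]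
    split_ifs with h
    · obtain ⟨m, hm⟩ := even_iff_exists_two_mul.mp h
      obtain ⟨k, rfl⟩ : ∃ k, m = k + 1 := ⟨m - 1, by omega⟩
      rw [show N / 2 = k by omega, hm, Nat.mul_div_cancel_left _ two_pos, harmonic_succ]
      push_cast
      field_simp
    · rw [Nat.even_add_one, not_not] at h
      obtain ⟨m, rfl⟩ := even_iff_exists_two_mul.mp h
      rw [show (2 * m + 1) / 2 = 2 * m / 2 by omega, add_zero]

theorem tendsto_log_div_two_sub_log :
    Tendsto (fun N : ℕ => Real.log ((N / 2 : ℕ) : ℝ) - Real.log N) atTop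
      (nhds (Real.log (1 / 2))) := by
  have h : Tendsto (fun N : ℕ => ((N / 2 : ℕ) : ℝ) / N) atTop (nhds (1 / 2)) := by
    have := (tendsto_nat_floor_mul_div_atTop (R := ℝ) (a := 1 / 2) (by norm_num)).comp
      tendsto_natCast_atTop_atTop
    refine this.congr fun N => ?_
    have : ⌊(1 / 2 : ℝ) * N⌋₊ = N / 2 := by
      rw [one_div_mul_eq_div]
      exact_mod_cast Nat.floor_div_eq_div (K := ℝ) N 2
    rw [Function.comp_apply, this]
  refine (h.log (by norm_num)).congr' ?_
  filter_upwards [eventually_ge_atTop 2] with N hN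
  exact Real.log_div (by exact_mod_cast (by omega : N / 2 ≠ 0)) (by positivity)

theorem exists_tendsto_sum_even_inv_sub_log :
    ∃ c : ℝ, Tendsto (fun N : ℕ =>
      ∑ d ∈ Icc 1 N, (if Even d then 1 / (d : ℝ) else 0) - 1 / 2 * Real.log N) atTop (nhds c) := by
  have h := (Real.tendsto_harmonic_sub_log.comp
    (Nat.tendsto_div_const_atTop two_ne_zero)).add tendsto_log_div_two_sub_log
  refine ⟨_, (h.const_mul (1 / 2)).congr fun N => ?_⟩
  rw [sum_even_inv_eq]
  simp only [Function.comp_apply]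
  ring

theorem exists_tendsto_neg_sum_sub_log (hab : ∀ n, |a n| ≤ b n)
    (hb : ∀ n : ℕ, 1 ≤ n → ∑ d ∈ n.divisors, (d : ℝ) * b d = 2 ^ n - 1)
    (ha : ∀ n : ℕ, 1 ≤ n →
      ∑ d ∈ n.divisors, (d : ℝ) * (if Odd (n / d) then a d else b d) = -1) :
    ∃ c : ℝ, Tendsto (fun N : ℕ =>
      ∑ d ∈ Icc 1 N, -a d * (2 : ℝ) ^ (-(d : ℝ) / 2) - 1 / 2 * Real.log N) atTop (nhds c) := by
  set e : ℕ → ℝ := fun n => if n = 0 then 0 else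
    -a n * (2 : ℝ) ^ (-(n : ℝ) / 2) - (if Even n then 1 / (n : ℝ) else 0) with he
  have hbound : ∀ n, ‖e n‖ ≤ 4 * ((2 : ℝ) ^ (-(1 / 6) : ℝ)) ^ n := by
    intro n
    rcases Nat.eq_zero_or_pos n with rfl | hn
    · simp [he]
    have hn0 : (1 : ℝ) ≤ n := by exact_mod_cast hn
    have hprod : e n = -((n * a n + if Even n then 2 ^ (n / 2) else 0) *
        ((2 : ℝ) ^ (-(n : ℝ) / 2) / n)) := by
      simp only [he, if_neg hn.ne']
      split_ifs with hev
      · obtain ⟨m, rfl⟩ := even_iff_exists_two_mul.mp hev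
        have hm : (2 : ℝ) ^ m * (2 : ℝ) ^ (-((2 * m : ℕ) : ℝ) / 2) = 1 := by
          rw [← Real.rpow_natCast, ← Real.rpow_add two_pos]
          push_cast
          ring_nf
          exact Real.rpow_zero 2
        rw [Nat.mul_div_cancel_left _ two_pos]
        generalize (2 : ℝ) ^ (-((2 * m : ℕ) : ℝ) / 2) = w at hm ⊢
        field_simp
        linear_combination hm
      · field_simp
        ring
    rw [hprod, norm_neg, norm_mul, Real.norm_eq_abs, Real.norm_eq_abs]
    have h1 : |(2 : ℝ) ^ (-(n : ℝ) / 2) / n| ≤ (2 : ℝ) ^ (-(n : ℝ) / 2) := by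
      rw [abs_of_nonneg (by positivity)]
      exact div_le_self (by positivity) hn0
    refine (mul_le_mul (abs_mul_add_le hab hb ha hn) h1 (abs_nonneg _) (by positivity)).trans ?_
    rw [← Real.rpow_natCast 2 (n / 3 + 2), ← Real.rpow_add two_pos, ← Real.rpow_natCast _ n,
      ← Real.rpow_mul two_pos.le,
      show (4 : ℝ) = 2 ^ (2 : ℝ) by norm_num, ← Real.rpow_add two_pos]
    refine Real.rpow_le_rpow_of_exponent_le one_le_two ?_
    have : ((n / 3 : ℕ) : ℝ) ≤ n / 3 := by exact_mod_cast Nat.cast_div_le (α := ℝ) (m := n) (n := 3)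
    push_cast
    linarith
  have hsum : Summable e := by
    refine Summable.of_norm_bounded (Summable.mul_left 4 (summable_geometric_of_lt_one
      (by positivity) ?_)) hbound
    exact Real.rpow_lt_one_of_one_lt_of_neg one_lt_two (by norm_num)
  obtain ⟨c, hc⟩ := exists_tendsto_sum_even_inv_sub_log
  refine ⟨_, ((hsum.hasSum.tendsto_sum_nat.comp (tendsto_add_atTop_nat 1)).add hc).congr
    fun N => ?_⟩
  have : ∑ d ∈ range (N + 1), e d = ∑ d ∈ Icc 1 N,
      (-a d * (2 : ℝ) ^ (-(d : ℝ) / 2) - (if Even d then 1 / (d : ℝ) else 0)) := by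

    rw [range_eq_Ico, sum_eq_sum_Ico_succ_bot (Nat.succ_pos N),
      show Ico (0 + 1) (N + 1) = Icc 1 N from rfl, show e 0 = 0 from if_pos rfl, zero_add]
    exact sum_congr rfl fun d hd => if_neg (Nat.one_le_iff_ne_zero.mp (mem_Icc.mp hd).1)
  rw [Function.comp_apply, this, sum_sub_distrib]
  ring

end Asymptotics

section ChebyshevBias

theorem setOf_eq_coe_filter (n : ℕ) (c : ZMod 2) :
    {P : (ZMod 2)[X] | P.Monic ∧ Irreducible P ∧ P.natDegree ≤ n ∧ P.coeff 0 = 1 ∧ P.coeff 1 = c} =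
      ({P ∈ (Icc 1 n).biUnion (monicIrreducibleOfDegree (ZMod 2)) |
        P.coeff 0 = 1 ∧ P.coeff 1 = c} : Finset (ZMod 2)[X]) := by
  ext P
  simp only [Set.mem_ofPred_eq, coe_filter, mem_biUnion, mem_Icc, mem_monicIrreducibleOfDegree]
  constructor
  · rintro ⟨hm, hi, hn, hc⟩
    exact ⟨⟨_, ⟨hi.natDegree_pos, hn⟩, hm, rfl, hi⟩, hc⟩
  · rintro ⟨⟨d, ⟨-, hn⟩, hm, rfl, hi⟩, hc⟩
    exact ⟨hm, hi, hn, hc⟩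

theorem pairwiseDisjoint_monicIrreducibleOfDegree {F : Type*} [Field F] [Fintype F] (s : Set ℕ) :
    s.PairwiseDisjoint (monicIrreducibleOfDegree F) := by
  intro d _ e _ hde
  refine disjoint_left.mpr fun P hd he => hde ?_
  rw [mem_monicIrreducibleOfDegree] at hd he
  exact hd.2.1.symm.trans he.2.1

theorem finsum_sub_finsum_eq (n : ℕ) :
    (∑ᶠ P ∈ {P : (ZMod 2)[X] | P.Monic ∧ Irreducible P ∧ P.natDegree ≤ n ∧
          P.coeff 0 = 1 ∧ P.coeff 1 = 1}, (2 : ℝ) ^ (-(P.natDegree : ℝ) / 2)) -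
        ∑ᶠ P ∈ {P : (ZMod 2)[X] | P.Monic ∧ Irreducible P ∧ P.natDegree ≤ n ∧
          P.coeff 0 = 1 ∧ P.coeff 1 = 0}, (2 : ℝ) ^ (-(P.natDegree : ℝ) / 2) =
      ∑ d ∈ Icc 1 n, -(∑ P ∈ monicIrreducibleOfDegree (ZMod 2) d, quadChar P) *
        (2 : ℝ) ^ (-(d : ℝ) / 2) := by
  rw [setOf_eq_coe_filter, setOf_eq_coe_filter, finsum_mem_coe_finset, finsum_mem_coe_finset,
    sum_filter, sum_filter, ← sum_sub_distrib,
    sum_biUnion (pairwiseDisjoint_monicIrreducibleOfDegree _)]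
  refine sum_congr rfl fun d _ => ?_
  rw [← sum_neg_distrib, sum_mul]
  refine sum_congr rfl fun P hP => ?_
  rw [quadChar_apply, (mem_monicIrreducibleOfDegree.mp hP).2.1]
  have h : ∀ x : ZMod 2, x = 0 ∨ x = 1 := by decide
  rcases h (P.coeff 0) with h0 | h0 <;> rcases h (P.coeff 1) with h1 | h1 <;> simp [h0, h1]

end ChebyshevBias

end MonicIrreducible

theorem stmt14 : ∃ c : ℝ, Tendsto (fun n : ℕ =>
    ((∑ᶠ P ∈ {P : Polynomial (ZMod 2) | P.Monic ∧ Irreducible P ∧ P.natDegree ≤ n ∧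
          P.coeff 0 = 1 ∧ P.coeff 1 = 1}, (2 : ℝ) ^ (-(P.natDegree : ℝ) / 2)) -
        ∑ᶠ P ∈ {P : Polynomial (ZMod 2) | P.Monic ∧ Irreducible P ∧ P.natDegree ≤ n ∧
          P.coeff 0 = 1 ∧ P.coeff 1 = 0}, (2 : ℝ) ^ (-(P.natDegree : ℝ) / 2)) -
      (1 / 2) * Real.log n)
    atTop (nhds c) := by
  simp_rw [finsum_sub_finsum_eq]
  exact exists_tendsto_neg_sum_sub_log
    (b := fun d => ∑ P ∈ monicIrreducibleOfDegree (ZMod 2) d, quadChar P ^ 2)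
    (fun d => (abs_sum_le_sum_abs _ _).trans_eq (sum_congr rfl fun P _ => abs_quadChar P))
    (fun _ hn => sum_divisors_quadChar_sq hn) (fun _ hn => sum_divisors_quadChar hn)
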